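/- For every s₁ with 0.295 ≤ s₁ ≤ √(8/5), the side length σ(s₁) of the largest square fitting into a side pocket satisfies 0.231 < σ(s₁) < 0.6. -/

import Mathlib

noncomputable section

/-- T⁻¹(s) = √(1 − s²/4) − s. -/
def Tinv (s : ℝ) : ℝ := Real.sqrt (1 - s ^ 2 / 4) - s

/-- T(u) = (2/5)(√(5 − u²) − 2u). -/
def Tfun (u : ℝ) : ℝ := 2 / 5 * (Real.sqrt (5 - u ^ 2) - 2 * u)

/-- s₁* = √((2 + √2)/3). -/
def s1star : ℝ := Real.sqrt ((2 + Real.sqrt 2) / 3)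

/-- σ(s₁), the side length of the largest square fitting into a side pocket. -/
def sigma (s₁ : ℝ) : ℝ :=
  if s₁ ≤ s1star then
    1 / 4 * (-s₁ - 2 * Tinv s₁ + Real.sqrt (8 - (s₁ - 2 * Tinv s₁) ^ 2))
  else
    1 / 5 * (Real.sqrt (20 - s₁ ^ 2) - 2 * s₁)

/-- w(y_t, h) = 2√(min{1 − y_t², 1 − (y_t − h)²}). -/
def wfun (yt h : ℝ) : ℝ := 2 * Real.sqrt (min (1 - yt ^ 2) (1 - (yt - h) ^ 2))

/-- X(a, b, u). -/
def Xfun (a b u : ℝ) : ℝ :=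
  if u ≤ 2 * min a (-b) then Tinv u else Real.sqrt (1 - (u - min a (-b)) ^ 2) - u

/-- Y(a, h, w, h′) = w/2 − h + X(a, a − h, h′). -/
def Yfun (a h w h' : ℝ) : ℝ := w / 2 - h + Xfun a (a - h) h'

/-- B₁(h, w, h′). -/
def B1 (h w h' : ℝ) : ℝ :=
  max (h * w / 2 + h ^ 2 / 4) (max (h ^ 2 + (w - h - h') * h') (h * (w + h) / 2 - h' ^ 2))

/-- B₂(h, w, h′). -/
def B2 (h w h' : ℝ) : ℝ :=
  if w < h + h' then h ^ 2
  else if w < 2 * h then h ^ 2 + h' ^ 2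
  else B1 h w h'

/-- B₃(a, h, w, h′). -/
def B3 (a h w h' : ℝ) : ℝ :=
  max (h ^ 2 + max (Yfun a h w h') 0 * h')
      (h ^ 2 + min (max (Yfun a h w h') 0 ^ 2) (2 * h' ^ 2))

/-- B₄(a, h, w, h′). -/
def B4 (a h w h' : ℝ) : ℝ := max (B2 h w h') (B3 a h w h')

/-- E(s₁, sₙ). -/
def Efun (s₁ sn : ℝ) : ℝ := if sn ≤ sigma s₁ then 0.83 * sigma s₁ ^ 2 else 0

/-- A(δ), the area of a circular segment of the unit disk of height δ. -/
def Aseg (δ : ℝ) : ℝ := Real.arccos (1 - δ) - (1 - δ) * Real.sqrt (1 - (1 - δ) ^ 2)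

/-- B₅(h, H) = A(H − h) + h² − H·h. -/
def B5 (h H : ℝ) : ℝ := Aseg (H - h) + h ^ 2 - H * h

/-- B₆(H_R, W_R, h′) = H_R·W_R/2 + h′·H_R/4. -/
def B6 (HR WR h' : ℝ) : ℝ := HR * WR / 2 + h' * HR / 4

theorem s1star_le : s1star ≤ 1.067 := by
  have h : Real.sqrt 2 ≤ 1.415 := Real.sqrt_le_iff.mpr (by norm_num)
  exact Real.sqrt_le_iff.mpr ⟨by norm_num, by linarith⟩

theorem one_le_s1star : 1 ≤ s1star :=
  Real.one_le_sqrt.mpr (by linarith [Real.one_le_sqrt.mpr one_le_two])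

/-- A chord below the concave function √(1 − s²/4). -/
theorem chord_le_sqrt {s : ℝ} (h₁ : 0.295 ≤ s) (h₂ : s ≤ 1.067) :
    0.989 - 0.188 * (s - 0.295) ≤ Real.sqrt (1 - s ^ 2 / 4) :=
  Real.le_sqrt_of_sq_le (by nlinarith [mul_nonneg (sub_nonneg.mpr h₁) (sub_nonneg.mpr h₂)])

theorem sigma_bounds_of_le {s : ℝ} (h₁ : 0.295 ≤ s) (h : s ≤ s1star) :
    0.231 < sigma s ∧ sigma s < 0.6 := by
  have hs : s ≤ 1.067 := h.trans s1star_le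
  have hchord := chord_le_sqrt h₁ hs
  have hsq : Real.sqrt (1 - s ^ 2 / 4) ^ 2 = 1 - s ^ 2 / 4 := Real.sq_sqrt (by nlinarith)
  have hr : Real.sqrt (1 - s ^ 2 / 4) ≤ 1 := Real.sqrt_le_one.mpr (by nlinarith)
  simp only [sigma, if_pos h, Tinv]
  generalize Real.sqrt (1 - s ^ 2 / 4) = r at *
  have hlower : 0.924 + 2 * r - s < Real.sqrt (8 - (s - 2 * (r - s)) ^ 2) := by
    refine Real.lt_sqrt_of_sq_lt ?_
    have hmul := mul_le_mul_of_nonneg_right hchord (by linarith : (0 : ℝ) ≤ 16 * s - 3.696)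
    nlinarith [mul_nonneg (sub_nonneg.mpr h₁) (sub_nonneg.mpr hs)]
  have hupper : Real.sqrt (8 - (s - 2 * (r - s)) ^ 2) < 2.4 + 2 * r - s := by
    refine (Real.sqrt_lt' (by linarith)).mpr ?_
    have hkey : r * (16 * s - 9.6) < 8 * s ^ 2 - 4.8 * s + 5.76 := by
      rcases le_total 0.6 s with hc | hc
      · nlinarith [mul_le_mul_of_nonneg_right hr (by linarith : (0 : ℝ) ≤ 16 * s - 9.6),
          sq_nonneg (s - 1.3)]
      · nlinarith [mul_nonneg (by linarith : (0 : ℝ) ≤ r) (sub_nonneg.mpr hc),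
          sq_nonneg (s - 0.3)]
    nlinarith
  constructor <;> linarith

theorem sigma_bounds_of_lt {s : ℝ} (h : s1star < s) (h₂ : s ≤ Real.sqrt (8 / 5)) :
    0.231 < sigma s ∧ sigma s < 0.6 := by
  have hs : 1 ≤ s := one_le_s1star.trans h.le
  have hsq : s ≤ 1.27 := h₂.trans (Real.sqrt_le_iff.mpr (by norm_num))
  rw [sigma, if_neg h.not_ge]
  have hlower : 1.155 + 2 * s < Real.sqrt (20 - s ^ 2) := Real.lt_sqrt_of_sq_lt (by nlinarith)
  have hupper : Real.sqrt (20 - s ^ 2) < 3 + 2 * s :=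
    (Real.sqrt_lt' (by linarith)).mpr (by nlinarith)
  constructor <;> linarith

theorem sigma_bounds (s₁ : ℝ) (h₁ : 0.295 ≤ s₁) (h₂ : s₁ ≤ Real.sqrt (8 / 5)) :
    0.231 < sigma s₁ ∧ sigma s₁ < 0.6 := by
  rcases le_or_gt s₁ s1star with h | h
  · exact sigma_bounds_of_le h₁ h
  · exact sigma_bounds_of_lt h h₂
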